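/- R(7,9) ≥ 242; that is, there exists a 2-coloring of the edges of the complete graph K_241 containing no monochromatic K_7 in color 1 and no monochromatic K_9 in color 2. -/

import Mathlib

open Finset

/-! ### Exhaustive clique search -/

section CliqueSearch

variable {α β : Type*}

theorem SimpleGraph.CliqueFree.card_lt {G : SimpleGraph β} {n : ℕ} (h : G.CliqueFree n)
    (s : Finset α) (f : α → β) (hf : ∀ x ∈ s, ∀ y ∈ s, x ≠ y → G.Adj (f x) (f y)) :
    #s < n := by
  classical
  by_contra! hn
  have hinj : Set.InjOn f s := fun x hx y hy hxy => by
    by_contra hne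
    exact (hf x hx y hy hne).ne hxy
  refine h.mono hn (s.image f) ⟨?_, card_image_of_injOn hinj⟩
  intro a ha b hb hab
  obtain ⟨x, hx, rfl⟩ := mem_image.1 (mem_coe.1 ha)
  obtain ⟨y, hy, rfl⟩ := mem_image.1 (mem_coe.1 hb)
  exact hf x hx y hy fun e => hab (congrArg f e)

/-- Whether `p` accepts, for every entry `v` of the list, the later entries related to `v`. -/
def allLaterNeighbors (adj : α → α → Bool) (p : List α → Bool) : List α → Bool
  | [] => true
  | v :: l => p (l.filter (adj v)) && allLaterNeighbors adj p l

/-- Backtracking search confirming that a list has no `k` pairwise related entries. -/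
def noClique (adj : α → α → Bool) : ℕ → List α → Bool
  | 0 => fun _ => false
  | k + 1 => allLaterNeighbors adj (noClique adj k)

theorem card_ne_of_noClique (adj : α → α → Bool) {k : ℕ} :
    ∀ {l : List α}, noClique adj k l = true → ∀ s : Finset α, (∀ x ∈ s, x ∈ l) →
      (∀ x ∈ s, ∀ y ∈ s, x ≠ y → adj x y = true) → #s ≠ k := by
  classical
  induction k with
  | zero => intro l h; simp [noClique] at h
  | succ k ih =>
    intro l
    induction l with
    | nil =>
      intro _ s hs _
      have : s = ∅ := eq_empty_of_forall_notMem fun x hx => by simpa using hs x hx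
      simp [this]
    | cons v l ihl =>
      intro h s hs hadj
      simp only [noClique, allLaterNeighbors, Bool.and_eq_true] at h
      by_cases hv : v ∈ s
      · have := ih h.1 (s.erase v)
          (fun x hx => by
            obtain ⟨hxv, hxs⟩ := mem_erase.1 hx
            have hxl : x ∈ l := by simpa [hxv] using hs x hxs
            exact List.mem_filter.2 ⟨hxl, hadj v hv x hxs hxv.symm⟩)
          (fun x hx y hy => hadj x (mem_of_mem_erase hx) y (mem_of_mem_erase hy))
        have hc := card_erase_add_one hv
        omega
      · refine ihl h.2 s (fun x hx => ?_) hadj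
        have hxv : x ≠ v := fun e => hv (e ▸ hx)
        simpa [hxv] using hs x hx

theorem cliqueFree_of_noClique {G : SimpleGraph β} (adj : α → α → Bool) {k : ℕ} {l : List α}
    (h : noClique adj k l = true) (f : β → α) (hinj : f.Injective) (hl : ∀ x, f x ∈ l)
    (hadj : ∀ x y, G.Adj x y → adj (f x) (f y) = true) : G.CliqueFree k := by
  classical
  intro s hs
  refine card_ne_of_noClique adj h (s.image f) ?_ ?_
    ((card_image_of_injective s hinj).trans hs.card_eq)
  · intro x hx
    obtain ⟨y, -, rfl⟩ := mem_image.1 hx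
    exact hl y
  · intro a ha b hb hab
    obtain ⟨x, hx, rfl⟩ := mem_image.1 ha
    obtain ⟨y, hy, rfl⟩ := mem_image.1 hb
    exact hadj x y (hs.isClique hx hy fun e => hab (congrArg f e))

end CliqueSearch

/-! ### Gluing a second graph along duplicated vertices -/

section Glue

variable {V ι κ : Type*} (G : SimpleGraph V) (H : SimpleGraph κ) (u : ι → V)
  (a b : ι → κ → Prop)

/-- Adjacency between `V ⊕ ι` and `κ`: the vertex `u i` of `V` is joined according to `a i`, and
the vertex `i` of `ι` according to `b i`. -/
def crossAdj : V ⊕ ι → κ → Prop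
  | .inl x, k => ∃ i, u i = x ∧ a i k
  | .inr i, k => b i k

/-- The disjoint union of `G`, of non-adjacent twins of the vertices `u i`, and of `H`, with the
edges of `crossAdj` added. -/
def glue : SimpleGraph ((V ⊕ ι) ⊕ κ) where
  Adj
    | .inl p, .inl q => G.Adj (Sum.elim id u p) (Sum.elim id u q)
    | .inl p, .inr k => crossAdj u a b p k
    | .inr k, .inl p => crossAdj u a b p k
    | .inr k, .inr l => H.Adj k l
  symm := ⟨by rintro (p | k) (q | l) h <;> first | exact h | exact h.symm⟩
  loopless := ⟨by rintro (p | k) h <;> exact h.ne rfl⟩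

/-- The part of `glue` that contains all its edges between the two sides. -/
def glueCore : SimpleGraph (ι ⊕ ι ⊕ κ) :=
  (glue G H u a b).comap
    (Sum.elim (fun i => .inl (.inl (u i))) (Sum.elim (fun i => .inl (.inr i)) .inr))

/-- Two vertices of `ι ⊕ κ` are adjacent if they, together with the vertices `u i` for those of
them that lie in `ι`, are independent in `glue`. -/
def glueExcess : SimpleGraph (ι ⊕ κ) where
  Adj
    | .inl i, .inl j => i ≠ j ∧ ¬ G.Adj (u i) (u j)
    | .inl i, .inr k => ¬ a i k ∧ ¬ b i k
    | .inr k, .inl i => ¬ a i k ∧ ¬ b i k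
    | .inr k, .inr l => k ≠ l ∧ ¬ H.Adj k l
  symm := ⟨by
    rintro (p | k) (q | l) h
    · exact ⟨h.1.symm, fun e => h.2 e.symm⟩
    · exact h
    · exact h
    · exact ⟨h.1.symm, fun e => h.2 e.symm⟩⟩
  loopless := ⟨by rintro (p | k) h <;> exact h.1 rfl⟩

variable {G H u a b}

theorem glue_cliqueFree (hu : u.Injective) {n : ℕ} (hG : G.CliqueFree n)
    (hcore : (glueCore G H u a b).CliqueFree n) :
    (glue G H u a b).CliqueFree n := by
  classical
  intro s hs
  have hadj : ∀ x ∈ s, ∀ y ∈ s, x ≠ y → (glue G H u a b).Adj x y := fun x hx y hy =>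
    hs.isClique hx hy
  have hcard := s.card_toLeft_add_card_toRight
  rw [hs.card_eq] at hcard
  obtain hempty | ⟨k, hk⟩ := s.toRight.eq_empty_or_nonempty
  · have := hG.card_lt s.toLeft (Sum.elim id u) fun p hp q hq hpq =>
      hadj _ (mem_toLeft.1 hp) _ (mem_toLeft.1 hq) (by simpa using hpq)
    simp [hempty] at hcard
    omega
  · have hrange : (s.toLeft.toLeft : Set V) ⊆ Set.range u := fun x hx => by
      obtain ⟨i, hi, -⟩ : crossAdj u a b (.inl x) k :=
        hadj _ (mem_toLeft.1 (mem_toLeft.1 hx)) _ (mem_toRight.1 hk) (by simp)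
      exact ⟨i, hi⟩
    have himage : (s.toLeft.toLeft.preimage u hu.injOn).image u = s.toLeft.toLeft := by
      rw [image_preimage, filter_true_of_mem hrange]
    have hcard' := card_image_of_injective (s.toLeft.toLeft.preimage u hu.injOn) hu
    rw [himage] at hcard'
    have := hcore.card_lt
      ((s.toLeft.toLeft.preimage u hu.injOn).disjSum (s.toLeft.toRight.disjSum s.toRight)) id (by
        rintro (i | i | k) hx (j | j | l) hy hxy <;>
          simp only [inl_mem_disjSum, inr_mem_disjSum, mem_preimage, mem_toLeft, mem_toRight]
            at hx hy <;>
          exact hadj _ hx _ hy (by simp_all [hu.eq_iff]))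
    rw [card_disjSum, card_disjSum, ← hcard', ← add_assoc, card_toLeft_add_card_toRight] at this
    omega

theorem glue_compl_cliqueFree (hu : u.Injective) {m n : ℕ} (hG : Gᶜ.CliqueFree (m + 1))
    (hexcess : (glueExcess G H u a b).CliqueFree (n + 1)) :
    (glue G H u a b)ᶜ.CliqueFree (m + n + 1) := by
  classical
  intro s hs
  have hadj : ∀ x ∈ s, ∀ y ∈ s, x ≠ y → ¬ (glue G H u a b).Adj x y := fun x hx y hy hxy =>
    (hs.isClique hx hy hxy).2
  set A := s.toLeft.toLeft with hA
  set B := s.toLeft.toRight with hB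
  set C := s.toRight with hC
  have hcard : #A + #B + #C = m + n + 1 := by
    rw [hA, hB, hC, card_toLeft_add_card_toRight, card_toLeft_add_card_toRight, hs.card_eq]
  have memA : ∀ {x}, x ∈ A → .inl (.inl x) ∈ s := fun h => mem_toLeft.1 (mem_toLeft.1 h)
  have memB : ∀ {i}, i ∈ B → .inl (.inr i) ∈ s := fun h => mem_toLeft.1 (mem_toRight.1 h)
  have memC : ∀ {k}, k ∈ C → .inr k ∈ s := fun h => mem_toRight.1 h
  have hB' := card_filter_add_card_filter_not (s := B) (fun i => u i ∈ A)
  have hfirst := hG.card_lt (A.disjSum (B.filter fun i => u i ∉ A)) (Sum.elim id u) (by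
    rintro (x | i) hx (y | j) hy hxy <;>
      simp only [inl_mem_disjSum, inr_mem_disjSum, mem_filter] at hx hy
    · exact ⟨by simpa using hxy, hadj _ (memA hx) _ (memA hy) (by simpa using hxy)⟩
    · exact ⟨fun e : x = u j => hy.2 (e ▸ hx), hadj _ (memA hx) _ (memB hy.1) (by simp)⟩
    · exact ⟨fun e : u i = y => hx.2 (e ▸ hy), hadj _ (memB hx.1) _ (memA hy) (by simp)⟩
    · exact ⟨fun e => hxy (congrArg _ (hu e)),
        hadj _ (memB hx.1) _ (memB hy.1) (by simpa using hxy)⟩)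
  have hcross : ∀ i ∈ B.filter (fun i => u i ∈ A), ∀ k ∈ C, ¬ a i k ∧ ¬ b i k := by
    intro i hi k hk
    obtain ⟨hi, hiA⟩ := mem_filter.1 hi
    exact ⟨fun h => hadj _ (memA hiA) _ (memC hk) (by simp) ⟨i, rfl, h⟩,
      hadj _ (memB hi) _ (memC hk) (by simp)⟩
  have hsecond := hexcess.card_lt ((B.filter fun i => u i ∈ A).disjSum C) id (by
    rintro (i | k) hx (j | l) hy hxy <;>
      simp only [inl_mem_disjSum, inr_mem_disjSum] at hx hy
    · exact ⟨by simpa using hxy,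
        hadj _ (memB (mem_filter.1 hx).1) _ (memB (mem_filter.1 hy).1) (by simpa using hxy)⟩
    · exact hcross i hx l hy
    · exact hcross j hy k hx
    · exact ⟨by simpa using hxy, hadj _ (memC hx) _ (memC hy) (by simpa using hxy)⟩)
  rw [card_disjSum] at hfirst hsecond
  omega

end Glue

/-! ### A self-complementary graph on the vectors of a plane over the field with 101 elements -/

section Determinant

instance : Fact (Nat.Prime 101) := ⟨by norm_num⟩

theorem isSquare_two_mul {x : ZMod 101} (h : ¬ IsSquare x) : IsSquare (2 * x) := by
  revert x
  decide +kernel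

theorem isSquare_neg_iff {x : ZMod 101} : IsSquare (-x) ↔ IsSquare x := by
  have h : IsSquare (-1 : ZMod 101) := ⟨10, by decide⟩
  exact ⟨fun hx => by simpa using h.mul hx, fun hx => by simpa using h.mul hx⟩

/-- The list of all `x` for which `x` and `x - 1` are nonzero squares. -/
def commonSquares : List (ZMod 101) :=
  (List.finRange 101).filter fun x : ZMod 101 => x ≠ 0 ∧ x ≠ 1 ∧ IsSquare x ∧ IsSquare (x - 1)

theorem card_le_of_isSquare_sub {c : ZMod 101} (hc : c ≠ 0) (s : Finset (ZMod 101))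
    (hs : ∀ x ∈ s, ∀ y ∈ s, IsSquare (c * (x - y))) : #s ≤ 5 := by
  by_contra! hcard
  obtain ⟨s, hsub, hcard⟩ := exists_subset_card_eq (n := 6) hcard
  replace hs : ∀ x ∈ s, ∀ y ∈ s, IsSquare (c * (x - y)) := fun x hx y hy =>
    hs x (hsub hx) y (hsub hy)
  obtain ⟨p, hp, q, hq, hpq⟩ := one_lt_card.1 (show 1 < #s by omega)
  have hqp : q - p ≠ 0 := sub_ne_zero.2 hpq.symm
  let f : ZMod 101 → ZMod 101 := fun x => (x - p) / (q - p)
  have hf : f.Injective := fun x y h => by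
    simpa [f, div_left_inj' hqp] using h
  have hdiff : ∀ x ∈ s, ∀ y ∈ s, IsSquare (f x - f y) := fun x hx y hy => by
    have : f x - f y = (c * (x - y)) / (c * (q - p)) := by
      simp only [f]; field_simp; ring
    rw [this]
    exact (hs x hx y hy).div (hs q hq p hp)
  have hf0 : f p = 0 := by simp [f]
  have hf1 : f q = 1 := div_self hqp
  have hno : noClique (fun x y : ZMod 101 => decide (IsSquare (x - y))) 4 commonSquares = true := by
    decide +kernel
  refine card_ne_of_noClique _ hno (((s.erase p).erase q).image f) ?_ ?_ ?_
  · intro z hz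
    obtain ⟨x, hx, rfl⟩ := mem_image.1 hz
    simp only [mem_erase] at hx
    refine List.mem_filter.2 ⟨List.mem_finRange _, ?_⟩
    have h0 := hdiff x hx.2.2 p hp
    have h1 := hdiff x hx.2.2 q hq
    rw [hf0, sub_zero] at h0
    rw [hf1] at h1
    exact decide_eq_true ⟨fun e => hx.2.1 (hf (e.trans hf0.symm)),
      fun e => hx.1 (hf (e.trans hf1.symm)), h0, h1⟩
  · intro z hz w hw _
    obtain ⟨x, hx, rfl⟩ := mem_image.1 hz
    obtain ⟨y, hy, rfl⟩ := mem_image.1 hw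
    exact decide_eq_true
      (hdiff x (mem_of_mem_erase (mem_of_mem_erase hx)) y (mem_of_mem_erase (mem_of_mem_erase hy)))
  · rw [card_image_of_injective _ hf, card_erase_of_mem (by simp [hq, hpq.symm]),
      card_erase_of_mem hp, hcard]

/-- The determinant of two vectors of the plane. -/
def planeDet {K : Type*} [CommRing K] (x y : K × K) : K := x.1 * y.2 - x.2 * y.1

theorem exists_planeDet_eq_one {K : Type*} [Field K] {x y : K × K} (h : planeDet x y ≠ 0) :
    ∃ w, planeDet x w = 1 := by
  refine ⟨((planeDet x y)⁻¹ * y.1, (planeDet x y)⁻¹ * y.2), ?_⟩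
  calc _ = (planeDet x y)⁻¹ * planeDet x y := by simp only [planeDet]; ring
    _ = 1 := inv_mul_cancel₀ h

theorem card_le_of_isSquare_planeDet {c : ZMod 101} (hc : c ≠ 0)
    (s : Finset (ZMod 101 × ZMod 101))
    (hs : ∀ x ∈ s, ∀ y ∈ s, x ≠ y → planeDet x y ≠ 0 ∧ IsSquare (c * planeDet x y)) :
    #s ≤ 6 := by
  by_contra! hcard
  obtain ⟨v, hv, v', hv', hvv'⟩ := one_lt_card.1 (show 1 < #s by omega)
  obtain ⟨w, hw⟩ := exists_planeDet_eq_one (hs v hv v' hv' hvv').1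
  let t : ZMod 101 × ZMod 101 → ZMod 101 := fun x => planeDet x w / planeDet v x
  have ht : ∀ x ∈ s.erase v, ∀ y ∈ s.erase v, t x - t y =
      planeDet x y / (planeDet v x * planeDet v y) := fun x hx y hy => by
    have hx0 := (hs v hv x (mem_of_mem_erase hx) (ne_of_mem_erase hx).symm).1
    have hy0 := (hs v hv y (mem_of_mem_erase hy) (ne_of_mem_erase hy).symm).1
    have key : planeDet x w * planeDet v y - planeDet v x * planeDet y w =
        planeDet x y * planeDet v w := by
      simp only [planeDet]; ring
    rw [div_sub_div _ _ hx0 hy0, key, hw, mul_one]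
  have hinj : Set.InjOn t (s.erase v) := fun x hx y hy hxy => by
    by_contra hne
    have hx0 := (hs v hv x (mem_of_mem_erase hx) (ne_of_mem_erase hx).symm).1
    have hy0 := (hs v hv y (mem_of_mem_erase hy) (ne_of_mem_erase hy).symm).1
    have := ht x hx y hy
    rw [hxy, sub_self, eq_comm, div_eq_zero_iff] at this
    exact this.elim (hs x (mem_of_mem_erase hx) y (mem_of_mem_erase hy) hne).1
      (mul_ne_zero hx0 hy0)
  have := card_le_of_isSquare_sub hc ((s.erase v).image t) (by
    intro a ha b hb
    obtain ⟨x, hx, rfl⟩ := mem_image.1 ha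
    obtain ⟨y, hy, rfl⟩ := mem_image.1 hb
    obtain rfl | hne := eq_or_ne x y
    · simp
    have hxs := hs v hv x (mem_of_mem_erase hx) (ne_of_mem_erase hx).symm
    have hys := hs v hv y (mem_of_mem_erase hy) (ne_of_mem_erase hy).symm
    have hxy := hs x (mem_of_mem_erase hx) y (mem_of_mem_erase hy) hne
    have : c * (t x - t y) = c * c * (c * planeDet x y) /
        ((c * planeDet v x) * (c * planeDet v y)) := by
      have := hxs.1
      have := hys.1
      rw [ht x hx y hy]
      field_simp
    rw [this]
    exact ((IsSquare.mul_self c).mul hxy.2).div (hxs.2.mul hys.2))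
  rw [card_image_of_injOn hinj, card_erase_of_mem hv] at this
  omega

/-- Representatives of the nonzero vectors of the plane up to multiplication by squares. -/
def planeRep : Bool × Option (ZMod 101) → ZMod 101 × ZMod 101
  | (b, some y) => (bif b then 2 else 1, bif b then 2 * y else y)
  | (b, none) => (0, bif b then 2 else 1)

theorem planeDet_planeRep (b c : Bool) (x y : Option (ZMod 101)) :
    planeDet (planeRep (b, x)) (planeRep (c, y)) = (bif b then 2 else 1) * (bif c then 2 else 1) *
      planeDet (planeRep (false, x)) (planeRep (false, y)) := by
  cases b <;> cases c <;> cases x <;> cases y <;> simp [planeDet, planeRep] <;> ring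

theorem planeDet_planeRep_eq_zero_iff {p q : Bool × Option (ZMod 101)} :
    planeDet (planeRep p) (planeRep q) = 0 ↔ p.2 = q.2 := by
  obtain ⟨b, x⟩ := p
  obtain ⟨c, y⟩ := q
  have h2 : (2 : ZMod 101) ≠ 0 := by decide
  have hb : ∀ b : Bool, (bif b then 2 else 1 : ZMod 101) ≠ 0 := by
    intro b; cases b <;> simp [h2]
  rw [planeDet_planeRep, mul_eq_zero, or_iff_right (mul_ne_zero (hb b) (hb c))]
  cases x <;> cases y <;> simp [planeDet, planeRep, sub_eq_zero, eq_comm]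

theorem planeRep_injective : planeRep.Injective := by
  intro p q h
  have h2 : (2 : ZMod 101) ≠ 1 := by decide
  have hx : p.2 = q.2 := planeDet_planeRep_eq_zero_iff.1 (by
    rw [h]; simp only [planeDet]; ring)
  obtain ⟨b, x⟩ := p
  obtain ⟨c, y⟩ := q
  obtain rfl : x = y := hx
  cases b <;> cases c <;> cases x <;> simp [planeRep, h2, h2.symm] at h ⊢

/-- The graph on the nonzero vectors up to squares in which two vectors are adjacent if their
determinant is not a square. -/
def planeGraph : SimpleGraph (Bool × Option (ZMod 101)) where
  Adj p q := ¬ IsSquare (planeDet (planeRep p) (planeRep q))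
  symm := ⟨fun p q h => by
    rwa [← isSquare_neg_iff, show -planeDet (planeRep q) (planeRep p) =
      planeDet (planeRep p) (planeRep q) by simp only [planeDet]; ring]⟩
  loopless := ⟨fun p h => h (by rw [planeDet_planeRep_eq_zero_iff.2 rfl]; exact .zero)⟩

theorem planeGraph_cliqueFree : planeGraph.CliqueFree 7 := by
  intro s hs
  have := card_le_of_isSquare_planeDet (c := 2) (by decide) (s.image planeRep) (by
    intro x hx y hy hxy
    obtain ⟨p, hp, rfl⟩ := mem_image.1 hx
    obtain ⟨q, hq, rfl⟩ := mem_image.1 hy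
    have h : ¬ IsSquare _ := hs.isClique hp hq fun e => hxy (congrArg _ e)
    exact ⟨fun e => h (e ▸ .zero), isSquare_two_mul h⟩)
  rw [card_image_of_injective _ planeRep_injective, hs.card_eq] at this
  omega

theorem planeGraph_compl_cliqueFree : planeGraphᶜ.CliqueFree 7 := by
  intro s hs
  have hsq : ∀ p ∈ s, ∀ q ∈ s, p ≠ q → IsSquare (planeDet (planeRep p) (planeRep q)) :=
    fun p hp q hq hpq => not_not.1 (hs.isClique hp hq hpq).2
  by_cases hzero : ∃ p ∈ s, ∃ q ∈ s, p ≠ q ∧ p.2 = q.2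
  · obtain ⟨⟨b, x⟩, hp, ⟨c, y⟩, hq, hpq, hxy⟩ := hzero
    obtain rfl : x = y := hxy
    have hsub : s ⊆ univ ×ˢ {x} := by
      rintro ⟨d, z⟩ hr
      by_contra hz
      have hz : x ≠ z := fun e => hz (by simp [e])
      have h1 := hsq _ hp _ hr (by simp [hz])
      have h2 := hsq _ hq _ hr (by simp [hz])
      have hne : planeDet (planeRep (true, x)) (planeRep (d, z)) ≠ 0 := fun e =>
        hz (planeDet_planeRep_eq_zero_iff.1 e)
      have htwo : planeDet (planeRep (true, x)) (planeRep (d, z)) =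
          2 * planeDet (planeRep (false, x)) (planeRep (d, z)) := by
        rw [planeDet_planeRep true d, planeDet_planeRep false d]; simp [mul_assoc]
      have hnot : ¬ IsSquare (2 : ZMod 101) := by decide +kernel
      rw [htwo] at hne
      have hratio := mul_div_cancel_right₀ (2 : ZMod 101) (right_ne_zero_of_mul hne)
      rw [← htwo] at hratio
      cases b <;> cases c <;> first | exact hpq rfl | skip
      · exact hnot (hratio ▸ h2.div h1)
      · exact hnot (hratio ▸ h1.div h2)
    have := card_le_card hsub
    rw [hs.card_eq] at this
    simp at this
  · push Not at hzero
    have := card_le_of_isSquare_planeDet (c := 1) one_ne_zero (s.image planeRep) (by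
      intro x hx y hy hxy
      obtain ⟨p, hp, rfl⟩ := mem_image.1 hx
      obtain ⟨q, hq, rfl⟩ := mem_image.1 hy
      have hpq : p ≠ q := fun e => hxy (congrArg _ e)
      exact ⟨fun e => hzero p hp q hq hpq (planeDet_planeRep_eq_zero_iff.1 e),
        by simpa using hsq p hp q hq hpq⟩)
    rw [card_image_of_injective _ planeRep_injective, hs.card_eq] at this
    omega

end Determinant

/-! ### The graph on 241 vertices -/

section Construction

/-- The vertices of `planeGraph` that are duplicated. -/
def twinBase : Fin 15 → Bool × Option (ZMod 101) :=
  ![(false, none), (true, some 0), (true, some 51), (true, some 1), (true, some 52),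
    (true, some 2), (true, some 3), (true, some 12), (true, some 13), (true, some 64),
    (true, some 40), (false, some 19), (false, some 21), (false, some 81), (false, some 88)]

/-- The adjacency matrix of the core, with rows in binary: first the 15 vertices of `twinBase`,
then their twins, then the 22 vertices of the second graph. -/
def coreRows : List ℕ :=
  [3436765251569662, 4234806589324517, 4269204922824139, 3256388300765141, 3297261154262953,
   3890489284214675, 4452269223832335, 3230622493430847, 3831154167688829, 2063215261186425,
   3778716737968575, 1863375784605554, 826029440462526, 1912975979404142, 1101620950547166,
   362843199178750, 110301176593637, 71513267369419, 105914898773973, 8934334455721,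
   48474607959955, 616152165135, 6048020681791, 2290681294461, 141856272611705, 20892010650047,
   297354753906, 701008670398, 37274213230, 20894923486, 3287486678907033, 2227401983531726,
   3395286749800116, 838849126362008, 2206151386345488, 4314309951901579, 4248432408866517,
   3306056579567529, 2125629848122228, 2950246462155807, 4341807190274123, 3655597031471286,
   3865286961864465, 3632665086983558, 4475828402392057, 4468014750979221, 4428345358415584,
   2109304626772344, 4210565819975678, 547551421954782, 2814051834933095, 1547808502973951]

/-- The entries of the matrix `coreRows`. -/
def coreBit (i j : ℕ) : Bool := (coreRows.getD i 0).testBit j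

theorem coreBit_comm : ∀ i < 52, ∀ j < 52, coreBit i j = coreBit j i := by decide +kernel

/-- The graph on 22 vertices that is glued to `planeGraph`. -/
def sideGraph : SimpleGraph (Fin 22) where
  Adj k l := coreBit (30 + k) (30 + l) = true
  symm := ⟨fun k l h => by rwa [coreBit_comm _ (by omega) _ (by omega)]⟩
  loopless := ⟨by
    have : ∀ k : Fin 22, coreBit (30 + k) (30 + k) = false := by decide +kernel
    intro k h
    simp [this] at h⟩

theorem planeGraph_adj_twinBase_iff : ∀ i j : Fin 15,
    planeGraph.Adj (twinBase i) (twinBase j) ↔ coreBit i j = true := by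
  have : ∀ i j : Fin 15,
      ¬ IsSquare (planeDet (planeRep (twinBase i)) (planeRep (twinBase j))) ↔
        coreBit i j = true := by decide +kernel
  exact this

theorem coreBit_twin : ∀ i j : Fin 15, coreBit i (15 + j) = coreBit i j ∧
    coreBit (15 + i) j = coreBit i j ∧ coreBit (15 + i) (15 + j) = coreBit i j := by
  decide +kernel

theorem twinBase_injective : twinBase.Injective := by decide +kernel

/-- The graph witnessing the bound, before its vertices are numbered. -/
def gluedGraph : SimpleGraph (((Bool × Option (ZMod 101)) ⊕ Fin 15) ⊕ Fin 22) :=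
  glue planeGraph sideGraph twinBase (fun i k => coreBit i (30 + k) = true)
    (fun i k => coreBit (15 + i) (30 + k) = true)

theorem gluedGraph_cliqueFree : gluedGraph.CliqueFree 7 := by
  refine glue_cliqueFree twinBase_injective planeGraph_cliqueFree ?_
  let code : Fin 15 ⊕ Fin 15 ⊕ Fin 22 → ℕ :=
    Sum.elim (fun i => i) (Sum.elim (fun i => 15 + i) (fun k => 30 + k))
  have hcode : ∀ x, code x < 52 := by rintro (i | i | k) <;> simp [code] <;> omega
  have hno : noClique (fun x y : ℕ × ℕ => x.2.testBit y.1) 7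
      ((List.range 52).zip coreRows) = true := by decide +kernel
  have hmem : ∀ i < 52, (i, coreRows.getD i 0) ∈ (List.range 52).zip coreRows := by
    decide +kernel
  refine cliqueFree_of_noClique _ hno (fun x => (code x, coreRows.getD (code x) 0)) ?_
    (fun x => hmem _ (hcode x)) ?_
  · intro x y h
    have h := congrArg Prod.fst h
    obtain i | i | k := x <;> obtain j | j | l := y <;>
      simp [code] at h ⊢ <;> omega
  · intro x y h
    change coreBit (code x) (code y) = true
    obtain i | i | k := x <;> obtain j | j | l := y
    · exact (planeGraph_adj_twinBase_iff i j).1 h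
    · exact (coreBit_twin i j).1.trans ((planeGraph_adj_twinBase_iff i j).1 h)
    · obtain ⟨i', hi', h⟩ := h
      rwa [twinBase_injective hi'] at h
    · exact (coreBit_twin i j).2.1.trans ((planeGraph_adj_twinBase_iff i j).1 h)
    · exact (coreBit_twin i j).2.2.trans ((planeGraph_adj_twinBase_iff i j).1 h)
    · exact h
    · rw [coreBit_comm _ (hcode _) _ (hcode _)]
      obtain ⟨j', hj', h⟩ := h
      rwa [twinBase_injective hj'] at h
    · rw [coreBit_comm _ (hcode _) _ (hcode _)]
      exact h
    · exact h

theorem gluedGraph_compl_cliqueFree : gluedGraphᶜ.CliqueFree 9 := by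
  refine glue_compl_cliqueFree (m := 6) (n := 2) twinBase_injective
    planeGraph_compl_cliqueFree ?_
  let adj : Fin 15 ⊕ Fin 22 → Fin 15 ⊕ Fin 22 → Bool
    | .inl i, .inl j => !coreBit i j
    | .inl i, .inr k => !coreBit i (30 + k) && !coreBit (15 + i) (30 + k)
    | .inr k, .inl i => !coreBit i (30 + k) && !coreBit (15 + i) (30 + k)
    | .inr k, .inr l => !coreBit (30 + k) (30 + l)
  have hno : noClique adj 3 ((List.finRange 15).map .inl ++ (List.finRange 22).map .inr) = true := by
    decide +kernel
  refine cliqueFree_of_noClique adj hno id Function.injective_id ?_ ?_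
  · rintro (i | k) <;> simp
  · rintro (i | k) (j | l) h
    · simpa [adj, planeGraph_adj_twinBase_iff] using h.2
    · simpa [adj, glueExcess] using h
    · simpa [adj, glueExcess] using h
    · simpa [adj, sideGraph] using h.2

end Construction

theorem ramsey_lower_bound_R_7_9 :
    ∃ G : SimpleGraph (Fin 241), G.CliqueFree 7 ∧ Gᶜ.CliqueFree 9 := by
  have hcard : Fintype.card (((Bool × Option (ZMod 101)) ⊕ Fin 15) ⊕ Fin 22) = 241 := by
    simp [ZMod.card]
  let e := (Fintype.equivFinOfCardEq hcard).symm
  refine ⟨gluedGraph.comap e, fun s hs => ?_, fun s hs => ?_⟩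
  · have := gluedGraph_cliqueFree.card_lt s e fun x hx y hy hxy => hs.isClique hx hy hxy
    exact this.ne hs.card_eq
  · have := gluedGraph_compl_cliqueFree.card_lt s e fun x hx y hy hxy =>
      ⟨fun h => hxy (e.injective h), (hs.isClique hx hy hxy).2⟩
    exact this.ne hs.card_eq
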